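/- arXiv:math/9911081 — 2 statements merged into one kernel-verified Lean document; each statement's English description precedes it below -/
import Mathlib

section
/- Let ℰ : End(A) → End(A) be defined by q(ℰ(f)(a)) = tr(ℓ(a) ∘ f ∘ r(q)) for all q ∈ A*, f ∈ End(A), a ∈ A, and for f ∈ End(A) and a ∈ A set f • a = r(a₍₁₎) ∘ f ∘ r(s(a₍₂₎)) (with an implicit Sweedler sum). Then r(a) ∘ ℰ(f) = ℰ(f • a) for all a ∈ A and f ∈ End(A). -/
open TensorProduct LinearMap HopfAlgebra Coalgebra

/-- The Hopf algebra identity `a₍₁₎ ⊗ a₍₂₎ s(a₍₃₎) = a ⊗ 1`. -/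
theorem sum_comul_mul_one_tmul_antipode {k A : Type*} [CommSemiring k] [Semiring A]
    [HopfAlgebra k A] {κ : Type*} [Fintype κ] {a : A} {a1 a2 : κ → A}
    (ha : comul (R := k) a = ∑ j, a1 j ⊗ₜ[k] a2 j) :
    ∑ j, comul (R := k) (a1 j) * (1 ⊗ₜ[k] antipode k (a2 j)) = a ⊗ₜ[k] (1 : A) := by
  have contract (t : A ⊗[k] A) (c : A) :
      (LinearMap.mul' k A ∘ₗ (antipode k).lTensor A).lTensor A
        (TensorProduct.assoc k A A A (t ⊗ₜ[k] c)) = t * (1 ⊗ₜ[k] antipode k c) := by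
    induction t using TensorProduct.induction_on with
    | zero => simp
    | tmul x y => simp
    | add x y hx hy => simp only [add_tmul, map_add, hx, hy, add_mul]
  have h := congrArg ((LinearMap.mul' k A ∘ₗ (antipode k).lTensor A).lTensor A)
    (Coalgebra.coassoc_apply (R := k) a)
  have hc := congrArg ((Algebra.linearMap k A).lTensor A)
    (Coalgebra.lTensor_counit_comul (R := k) a)
  rw [ha] at h hc
  simp only [map_sum, rTensor_tmul, lTensor_tmul, contract, comp_apply,
    mul_antipode_lTensor_comul_apply, Algebra.linearMap_apply, map_one] at h hc
  rw [h, hc]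

/-- The maps `b ↦ q(b₍₁₎) b₍₂₎` and right multiplications satisfy
`r(s(a₍₂₎)) ∘ r(q) ∘ r(a₍₁₎) = r(q(· a))`. -/
theorem sum_mulRight_antipode_comp_rTensor_comul_comp_mulRight {k A : Type*} [CommSemiring k]
    [Semiring A] [HopfAlgebra k A] {κ : Type*} [Fintype κ] {a : A} {a1 a2 : κ → A}
    (ha : comul (R := k) a = ∑ j, a1 j ⊗ₜ[k] a2 j) (q : Module.Dual k A) :
    ∑ j, mulRight k (antipode k (a2 j)) ∘ₗ
        ((TensorProduct.lid k A).toLinearMap ∘ₗ q.rTensor A ∘ₗ comul (R := k)) ∘ₗ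
          mulRight k (a1 j) =
      (TensorProduct.lid k A).toLinearMap ∘ₗ (q ∘ₗ mulRight k a).rTensor A ∘ₗ
        comul (R := k) := by
  have right_mul (t : A ⊗[k] A) (c : A) :
      TensorProduct.lid k A (q.rTensor A t) * c =
        TensorProduct.lid k A (q.rTensor A (t * (1 ⊗ₜ[k] c))) := by
    induction t using TensorProduct.induction_on with
    | zero => simp
    | tmul x y => simp
    | add x y hx hy => simp only [map_add, hx, hy, add_mul]
  have left_mul (t : A ⊗[k] A) :
      q.rTensor A (t * (a ⊗ₜ[k] 1)) = (q ∘ₗ mulRight k a).rTensor A t := by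
    induction t using TensorProduct.induction_on with
    | zero => simp
    | tmul x y => simp
    | add x y hx hy => simp only [map_add, hx, hy, add_mul]
  ext x
  simp only [LinearMap.sum_apply, comp_apply, mulRight_apply, LinearEquiv.coe_coe,
    Bialgebra.comul_mul, right_mul, mul_assoc]
  rw [← map_sum, ← map_sum, ← Finset.mul_sum, sum_comul_mul_one_tmul_antipode ha, left_mul]

/-- Let `A` be a finite-dimensional Hopf algebra over a field `k` with antipode
`s`, and let `ℰ : End(A) → End(A)` be defined by `q(ℰ(f)(a)) = tr(ℓ(a) ∘ f ∘ r(q))`.  For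
`f ∈ End(A)` and `a ∈ A` set `f • a = r(a₍₁₎) ∘ f ∘ r(s(a₍₂₎))` (implicit Sweedler sum,
stated via an arbitrary finite representation `Δ a = ∑ⱼ a1ⱼ ⊗ a2ⱼ`).  Then
`r(a) ∘ ℰ(f) = ℰ(f • a)` for all `a` and `f`. -/
theorem stmt16 (k A : Type*) [Field k] [Ring A] [HopfAlgebra k A] [FiniteDimensional k A]
    (E : (A →ₗ[k] A) →ₗ[k] (A →ₗ[k] A))
    (hE : ∀ (q : Module.Dual k A) (f : A →ₗ[k] A) (a : A),
      q (E f a) = LinearMap.trace k A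
        (LinearMap.mulLeft k a ∘ₗ f ∘ₗ
          ((TensorProduct.lid k A).toLinearMap ∘ₗ q.rTensor A ∘ₗ comul (R := k))))
    (a : A) (f : A →ₗ[k] A)
    (κ : Type) [Fintype κ] (a1 a2 : κ → A)
    (ha : comul (R := k) a = ∑ j, a1 j ⊗ₜ[k] a2 j) :
    LinearMap.mulRight k a ∘ₗ E f =
      E (∑ j, LinearMap.mulRight k (a1 j) ∘ₗ f ∘ₗ
          LinearMap.mulRight k (antipode (R := k) (a2 j))) := by
  ext b
  refine Module.eval_apply_injective k ?_
  ext q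
  change (q ∘ₗ mulRight k a) (E f b) = q (E _ b)
  rw [hE, hE, ← sum_mulRight_antipode_comp_rTensor_comul_comp_mulRight ha q]
  simp only [← Module.End.mul_eq_comp, Finset.mul_sum, Finset.sum_mul, map_sum]
  refine Finset.sum_congr rfl fun j _ => ?_
  set R := (TensorProduct.lid k A).toLinearMap ∘ₗ q.rTensor A ∘ₗ comul (R := k)
  have hcomm : mulLeft k b ∘ₗ mulRight k (a1 j) = mulRight k (a1 j) ∘ₗ mulLeft k b :=
    LinearMap.ext fun x => (mul_assoc b x (a1 j)).symm
  calc
    _ = trace k A ((mulLeft k b ∘ₗ f ∘ₗ mulRight k (antipode k (a2 j)) ∘ₗ R) ∘ₗ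
          mulRight k (a1 j)) := rfl
    _ = trace k A (mulRight k (a1 j) ∘ₗ mulLeft k b ∘ₗ f ∘ₗ
          mulRight k (antipode k (a2 j)) ∘ₗ R) := trace_comp_comm' _ _
    _ = trace k A ((mulRight k (a1 j) ∘ₗ mulLeft k b) ∘ₗ f ∘ₗ
          mulRight k (antipode k (a2 j)) ∘ₗ R) := rfl
    _ = _ := by rw [← hcomm]; rfl
end

section
/- Let ℰ : End(A) → End(A) be defined by q(ℰ(f)(a)) = tr(ℓ(a) ∘ f ∘ r(q)) for all q ∈ A*, f ∈ End(A), a ∈ A, and for f ∈ End(A) and p ∈ A* let f • p ∈ End(A) be the map given by (f • p)(b) = f(b₍₁₎)₍₁₎ · p(b₍₂₎ · s(f(b₍₁₎)₍₂₎)) for all b ∈ A. Then ℰ(f) ∘ ℓ(p) = ℰ(f • p) for all f ∈ End(A) and p ∈ A*, where ℓ(p)(b) = b₍₁₎ p(b₍₂₎). -/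
open TensorProduct LinearMap HopfAlgebra Coalgebra

namespace HopfAlgebra

section CommSemiring

variable {k A : Type*} [CommSemiring k]

section Coalgebra

variable [AddCommMonoid A] [Module k A] [Coalgebra k A]

/-- The endomorphism `b ↦ b₍₁₎ p(b₍₂₎)`. -/
noncomputable def leftHit (p : Module.Dual k A) : A →ₗ[k] A :=
  (TensorProduct.rid k A).toLinearMap ∘ₗ p.lTensor A ∘ₗ comul (R := k)

/-- The endomorphism `b ↦ q(b₍₁₎) b₍₂₎`. -/
noncomputable def rightHit (q : Module.Dual k A) : A →ₗ[k] A :=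
  (TensorProduct.lid k A).toLinearMap ∘ₗ q.rTensor A ∘ₗ comul (R := k)

theorem comul_rightHit (q : Module.Dual k A) (b : A) :
    comul (R := k) (rightHit q b) = (rightHit q).rTensor A (comul (R := k) b) := by
  have h₁ : comul (R := k) (rightHit q b) = (TensorProduct.lid k (A ⊗[k] A)).toLinearMap
      (q.rTensor (A ⊗[k] A) ((comul (R := k)).lTensor A (comul (R := k) b))) := by
    simp only [rightHit, LinearMap.comp_apply, ← (ℛ k b).eq]
    simp [map_sum]
  have h₂ : ∀ t : (A ⊗[k] A) ⊗[k] A, (TensorProduct.lid k (A ⊗[k] A)).toLinearMap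
      (q.rTensor (A ⊗[k] A) (TensorProduct.assoc k A A A t)) =
      ((TensorProduct.lid k A).toLinearMap ∘ₗ q.rTensor A).rTensor A t := by
    intro t
    rw [← LinearEquiv.coe_coe, ← LinearMap.comp_apply, ← LinearMap.comp_apply]
    congr 1
    ext
    simp [TensorProduct.smul_tmul']
  rw [h₁, ← coassoc_apply, h₂, ← LinearMap.comp_apply, ← LinearMap.rTensor_comp]
  rfl

end Coalgebra

variable [Semiring A] [HopfAlgebra k A]

/-- The functional `b ↦ φ(b₍₁₎) p(b₍₂₎ s(d))`. -/
noncomputable def twistedConv (p φ : Module.Dual k A) (d : A) : Module.Dual k A :=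
  LinearMap.mul' k k ∘ₗ TensorProduct.map φ (p ∘ₗ LinearMap.mulRight k (antipode k d)) ∘ₗ
    comul (R := k)

/-- The endomorphism `b ↦ f(b₍₁₎)₍₁₎ p(b₍₂₎ s(f(b₍₁₎)₍₂₎))`. -/
noncomputable def dualAction (p : Module.Dual k A) (f : A →ₗ[k] A) : A →ₗ[k] A :=
  (TensorProduct.rid k A).toLinearMap ∘ₗ
    (p ∘ₗ LinearMap.mul' k A ∘ₗ (antipode k).lTensor A ∘ₗ
      (TensorProduct.comm k A A).toLinearMap).lTensor A ∘ₗ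
    (TensorProduct.assoc k A A A).toLinearMap ∘ₗ
    (comul (R := k) ∘ₗ f).rTensor A ∘ₗ comul (R := k)

theorem dualAction_zero (p : Module.Dual k A) : dualAction p (0 : A →ₗ[k] A) = 0 := by
  simp [dualAction]

theorem dualAction_add (p : Module.Dual k A) (f g : A →ₗ[k] A) :
    dualAction p (f + g) = dualAction p f + dualAction p g := by
  simp [dualAction, LinearMap.comp_add, LinearMap.add_comp, LinearMap.rTensor_add]

theorem dualAction_apply (p : Module.Dual k A) (f : A →ₗ[k] A) {b : A} {ι : Type*} [Fintype ι]
    {b₁ b₂ : ι → A} (hb : comul (R := k) b = ∑ i, b₁ i ⊗ₜ[k] b₂ i)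
    {κ : ι → Type*} [∀ i, Fintype (κ i)] {c₁ c₂ : ∀ i, κ i → A}
    (hc : ∀ i, comul (R := k) (f (b₁ i)) = ∑ j, c₁ i j ⊗ₜ[k] c₂ i j) :
    dualAction p f b = ∑ i, ∑ j, p (b₂ i * antipode k (c₂ i j)) • c₁ i j := by
  simp [dualAction, hb, hc, map_sum, TensorProduct.sum_tmul]

theorem dualAction_dualTensorHom (p φ : Module.Dual k A) {c : A} {ι : Type*} [Fintype ι]
    {c₁ c₂ : ι → A} (hc : comul (R := k) c = ∑ j, c₁ j ⊗ₜ[k] c₂ j) :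
    dualAction p (dualTensorHom k A A (φ ⊗ₜ c)) =
      ∑ j, dualTensorHom k A A (twistedConv p φ (c₂ j) ⊗ₜ c₁ j) := by
  ext b
  simp only [dualAction, twistedConv, LinearMap.sum_apply, dualTensorHom_apply,
    LinearMap.comp_apply, ← (ℛ k b).eq]
  simp only [map_sum, LinearMap.rTensor_tmul, LinearMap.comp_apply, dualTensorHom_apply, map_smul, hc,
    TensorProduct.sum_tmul, TensorProduct.smul_tmul', Finset.smul_sum]
  rw [Finset.sum_comm]
  simp [Finset.sum_smul, smul_smul, mul_comm]

/-- The identity `c₍₁₎ ⊗ c₍₂₎ s(c₍₃₎) = c ⊗ 1`. -/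
theorem sum_comul_mul_antipode {c : A} {ι : Type*} [Fintype ι]
    {c₁ c₂ : ι → A} (hc : comul (R := k) c = ∑ j, c₁ j ⊗ₜ[k] c₂ j) :
    ∑ j, comul (R := k) (c₁ j) * (1 ⊗ₜ[k] antipode k (c₂ j)) = c ⊗ₜ[k] (1 : A) := by
  have h₁ : ∀ x y : A, comul (R := k) x * (1 ⊗ₜ[k] antipode k y) =
      (LinearMap.mul' k A ∘ₗ (antipode k).lTensor A).lTensor A
        (TensorProduct.assoc k A A A (comul (R := k) x ⊗ₜ[k] y)) := by
    intro x y
    rw [← (ℛ k x).eq]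
    simp [TensorProduct.sum_tmul, Finset.sum_mul]
  have h₂ : ∑ j, comul (R := k) (c₁ j) ⊗ₜ[k] c₂ j =
      (comul (R := k)).rTensor A (comul (R := k) c) := by
    simp [hc]
  simp only [h₁, ← map_sum, h₂, coassoc_apply]
  rw [← LinearMap.comp_apply, ← LinearMap.lTensor_comp, LinearMap.comp_assoc,
    mul_antipode_lTensor_comul, LinearMap.lTensor_comp, LinearMap.comp_apply,
    lTensor_counit_comul]
  simp

theorem sum_twistedConv_mul (p φ : Module.Dual k A) (a : A) {c : A} {ι : Type*} [Fintype ι]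
    {c₁ c₂ : ι → A} (hc : comul (R := k) c = ∑ j, c₁ j ⊗ₜ[k] c₂ j) :
    ∑ j, twistedConv p φ (c₂ j) (a * c₁ j) = φ (leftHit p a * c) := by
  have h₁ : ∀ x d : A, twistedConv p φ d x =
      LinearMap.mul' k k (TensorProduct.map φ p (comul (R := k) x * (1 ⊗ₜ[k] antipode k d))) := by
    intro x d
    simp only [twistedConv, LinearMap.comp_apply, ← (ℛ k x).eq]
    simp [Finset.sum_mul]
  simp only [h₁, Bialgebra.comul_mul, mul_assoc, ← map_sum, ← Finset.mul_sum,
    sum_comul_mul_antipode hc]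
  simp only [leftHit, LinearMap.comp_apply, ← (ℛ k a).eq]
  simp [Finset.sum_mul, mul_comm]

theorem twistedConv_rightHit (p φ q : Module.Dual k A) (d b : A) :
    twistedConv p φ d (rightHit q b) = twistedConv p (φ ∘ₗ rightHit q) d b := by
  simp only [twistedConv, LinearMap.comp_apply, comul_rightHit]
  rw [← LinearMap.comp_apply (TensorProduct.map _ _), LinearMap.map_comp_rTensor]

end CommSemiring

section Field

variable {k A : Type*} [Field k] [Ring A] [HopfAlgebra k A] [FiniteDimensional k A]

theorem trace_mulLeft_comp_dualTensorHom_comp (a : A) (φ : Module.Dual k A) (c : A)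
    (r : A →ₗ[k] A) :
    LinearMap.trace k A (LinearMap.mulLeft k a ∘ₗ dualTensorHom k A A (φ ⊗ₜ c) ∘ₗ r) =
      φ (r (a * c)) := by
  have h : LinearMap.mulLeft k a ∘ₗ dualTensorHom k A A (φ ⊗ₜ c) ∘ₗ r =
      dualTensorHom k A A ((φ ∘ₗ r) ⊗ₜ (a * c)) := by
    ext b
    simp
  rw [h, LinearMap.trace_eq_contract_apply, contractLeft_apply, LinearMap.comp_apply]

theorem trace_mulLeft_leftHit_comp (p q : Module.Dual k A) (f : A →ₗ[k] A) (a : A) :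
    LinearMap.trace k A (LinearMap.mulLeft k (leftHit p a) ∘ₗ f ∘ₗ rightHit q) =
      LinearMap.trace k A (LinearMap.mulLeft k a ∘ₗ dualAction p f ∘ₗ rightHit q) := by
  obtain ⟨t, rfl⟩ := (dualTensorHomEquiv k A A).surjective f
  induction t with
  | zero => simp [dualAction_zero]
  | add x y hx hy =>
    simp only [map_add, dualAction_add, LinearMap.add_comp, LinearMap.comp_add, hx, hy]
  | tmul φ c =>
    obtain ⟨n, c₁, c₂, hc⟩ := TensorProduct.exists_sum_tmul_eq (comul (R := k) c)
    have h : dualTensorHomEquiv k A A (φ ⊗ₜ c) = dualTensorHom k A A (φ ⊗ₜ c) := rfl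
    have sum_mulLeft_comp (F : Fin n → A →ₗ[k] A) :
        LinearMap.mulLeft k a ∘ₗ (∑ j, F j) ∘ₗ rightHit q =
          ∑ j, LinearMap.mulLeft k a ∘ₗ F j ∘ₗ rightHit q := by
      ext
      simp
    rw [h, dualAction_dualTensorHom p φ hc, trace_mulLeft_comp_dualTensorHom_comp,
      sum_mulLeft_comp, map_sum]
    simp only [trace_mulLeft_comp_dualTensorHom_comp, twistedConv_rightHit,
      sum_twistedConv_mul p _ a hc, LinearMap.comp_apply]

end Field

end HopfAlgebra

/-- Let `A` be a finite-dimensional Hopf algebra over a field `k` with antipode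
`s`, and let `ℰ : End(A) → End(A)` be defined by `q(ℰ(f)(a)) = tr(ℓ(a) ∘ f ∘ r(q))`.  For
`f ∈ End(A)` and `p ∈ A*` let `f • p ∈ End(A)` be the map given by
`(f • p)(b) = f(b₍₁₎)₍₁₎ · p(b₍₂₎ · s(f(b₍₁₎)₍₂₎))` (stated via arbitrary finite
representations `Δ b = ∑ᵢ b1ᵢ ⊗ b2ᵢ` and `Δ (f (b1ᵢ)) = ∑ⱼ c1ᵢⱼ ⊗ c2ᵢⱼ`).  Then
`ℰ(f) ∘ ℓ(p) = ℰ(f • p)`, where `ℓ(p) b = b₍₁₎ p(b₍₂₎)`. -/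
theorem stmt17 (k A : Type*) [Field k] [Ring A] [HopfAlgebra k A] [FiniteDimensional k A]
    (E : (A →ₗ[k] A) →ₗ[k] (A →ₗ[k] A))
    (hE : ∀ (q : Module.Dual k A) (f : A →ₗ[k] A) (a : A),
      q (E f a) = LinearMap.trace k A
        (LinearMap.mulLeft k a ∘ₗ f ∘ₗ
          ((TensorProduct.lid k A).toLinearMap ∘ₗ q.rTensor A ∘ₗ comul (R := k))))
    (f : A →ₗ[k] A) (p : Module.Dual k A)
    (g : A →ₗ[k] A)
    (hg : ∀ (b : A) (ι : Type) [Fintype ι] (b1 b2 : ι → A),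
      comul (R := k) b = ∑ i, b1 i ⊗ₜ[k] b2 i →
      ∀ (κ : ι → Type) [∀ i, Fintype (κ i)] (c1 c2 : ∀ i, κ i → A),
        (∀ i, comul (R := k) (f (b1 i)) = ∑ j, c1 i j ⊗ₜ[k] c2 i j) →
        g b = ∑ i, ∑ j, p (b2 i * antipode (R := k) (c2 i j)) • c1 i j) :
    E f ∘ₗ ((TensorProduct.rid k A).toLinearMap ∘ₗ p.lTensor A ∘ₗ comul (R := k)) =
      E g := by
  have hgp : g = dualAction p f := by
    ext b
    obtain ⟨n, b₁, b₂, hb⟩ := TensorProduct.exists_sum_tmul_eq (comul (R := k) b)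
    choose m c₁ c₂ hc using fun i ↦ TensorProduct.exists_sum_tmul_eq (comul (R := k) (f (b₁ i)))
    rw [hg b (Fin n) b₁ b₂ hb (fun i ↦ Fin (m i)) c₁ c₂ hc, dualAction_apply p f hb hc]
  ext a
  refine sub_eq_zero.mp ((Module.forall_dual_apply_eq_zero_iff k _).mp fun q ↦ ?_)
  rw [map_sub, sub_eq_zero, hE, hgp, LinearMap.comp_apply, hE]
  exact trace_mulLeft_leftHit_comp p q f a
end
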